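/- Lozinskii's theorem: the Fourier projection F_n is a minimal projection in 𝒫(C(2π), Π_n) with respect to the operator norm, i.e. ‖F_n‖ ≤ ‖P‖ for every projection P ∈ 𝒫(C(2π), Π_n). -/

import Mathlib

open MeasureTheory
open scoped Real ENNReal

instance : Fact (0 < 2 * π) := ⟨by positivity⟩

/-- `C(2π)`: continuous `2π`-periodic real-valued functions with the sup norm. -/
abbrev C2pi : Type := C(AddCircle (2 * π), ℝ)

/-- `cos (k t)` as an element of `C(2π)`. -/
noncomputable def cosF (k : ℕ) : C2pi :=
  ⟨fun t => (fourier (T := 2 * π) k t).re, (Complex.continuous_re.comp (map_continuous _))⟩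

/-- `sin (k t)` as an element of `C(2π)`. -/
noncomputable def sinF (k : ℕ) : C2pi :=
  ⟨fun t => (fourier (T := 2 * π) k t).im, (Complex.continuous_im.comp (map_continuous _))⟩

/-- `Π_n`: the space of trigonometric polynomials of degree at most `n`. -/
noncomputable def trigPoly (n : ℕ) : Submodule ℝ C2pi :=
  Submodule.span ℝ {f : C2pi | ∃ k : ℕ, k ≤ n ∧ (f = cosF k ∨ f = sinF k)}

/-- The `L²`-inner-product coefficient functional `f ↦ ∫₀^{2π} f(t) g(t) dt`. -/
noncomputable def coeffCLM (g : C2pi) : C2pi →L[ℝ] ℝ :=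
  (innerSL ℝ (ContinuousMap.toLp (E := ℝ) 2 volume ℝ g)).comp
    (ContinuousMap.toLp (E := ℝ) 2 volume ℝ)

/-- The Fourier projection `F_n : C(2π) → Π_n`, sending `f` to its `n`-th Fourier
partial sum. -/
noncomputable def fourierProj (n : ℕ) : C2pi →L[ℝ] C2pi :=
  (1 / (2 * π)) • (coeffCLM (cosF 0)).smulRight (cosF 0) +
    ∑ k ∈ Finset.Icc 1 n,
      ((1 / π) • ((coeffCLM (cosF k)).smulRight (cosF k) +
        (coeffCLM (sinF k)).smulRight (sinF k)))

/-- Translation operator `(T_g f)(t) = f(t + g)` on `C(2π)`. -/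
noncomputable def translateBy (g : ℝ) (f : C2pi) : C2pi :=
  f.comp ⟨fun t => t + (g : AddCircle (2 * π)), by continuity⟩

theorem cosF_apply (k : ℕ) (t : AddCircle (2 * π)) : cosF k t = (fourier (k : ℤ) t).re := rfl

theorem sinF_apply (k : ℕ) (t : AddCircle (2 * π)) : sinF k t = (fourier (k : ℤ) t).im := rfl

theorem fourier_apply_add (m : ℤ) (s t : AddCircle (2 * π)) :
    fourier m (s + t) = fourier m s * fourier m t := by
  simp [fourier_apply, AddCircle.toCircle_add]

theorem cosF_add (k : ℕ) (s t : AddCircle (2 * π)) :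
    cosF k (s + t) = cosF k s * cosF k t - sinF k s * sinF k t := by
  simp only [cosF_apply, sinF_apply, fourier_apply_add, Complex.mul_re]

theorem sinF_add (k : ℕ) (s t : AddCircle (2 * π)) :
    sinF k (s + t) = cosF k s * sinF k t + sinF k s * cosF k t := by
  simp only [cosF_apply, sinF_apply, fourier_apply_add, Complex.mul_im]

theorem fourier_apply_neg (m : ℤ) (t : AddCircle (2 * π)) :
    fourier m (-t) = (starRingEnd ℂ) (fourier m t) := by
  rw [← fourier_neg, fourier_apply, fourier_apply, smul_neg, neg_smul]

theorem cosF_sub (k : ℕ) (s t : AddCircle (2 * π)) :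
    cosF k (s - t) = cosF k s * cosF k t + sinF k s * sinF k t := by
  simp only [cosF_apply, sinF_apply, sub_eq_add_neg s t, fourier_apply_add, fourier_apply_neg,
    Complex.mul_re, Complex.conj_re, Complex.conj_im]
  ring

theorem sinF_sub (k : ℕ) (s t : AddCircle (2 * π)) :
    sinF k (s - t) = sinF k s * cosF k t - cosF k s * sinF k t := by
  simp only [cosF_apply, sinF_apply, sub_eq_add_neg s t, fourier_apply_add, fourier_apply_neg,
    Complex.mul_im, Complex.conj_re, Complex.conj_im]
  ring

theorem sinF_zero : sinF 0 = 0 := by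
  ext t; simp [sinF_apply]

theorem coeffCLM_apply (g f : C2pi) : coeffCLM g f = ∫ t, f t * g t := by
  simpa [coeffCLM] using ContinuousMap.inner_toLp (𝕜 := ℝ) (volume : Measure (AddCircle (2 * π))) g f

theorem integral_fourier (m : ℤ) :
    ∫ t : AddCircle (2 * π), fourier m t = if m = 0 then (2 * π : ℂ) else 0 := by
  split_ifs with h
  · subst h
    simp [Measure.real, AddCircle.measure_univ, Real.pi_pos.le]
  · exact integral_eq_zero_of_add_right_eq_neg
      (fourier_add_half_inv_index h (Fact.out : 0 < 2 * π))

theorem integrable_of_continuous {E : Type*} [NormedAddCommGroup E] {f : AddCircle (2 * π) → E}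
    (hf : Continuous f) : Integrable f :=
  hf.integrable_of_hasCompactSupport (HasCompactSupport.of_compactSpace f)

theorem integral_fourier_re (m : ℤ) :
    ∫ t : AddCircle (2 * π), (fourier m t).re = if m = 0 then 2 * π else 0 := by
  have h := integral_re (𝕜 := ℂ)
    (integrable_of_continuous (f := fun t => fourier m t) (map_continuous _))
  simp only [RCLike.re_to_complex] at h
  rw [h, integral_fourier]
  split_ifs <;> simp

theorem integral_fourier_im (m : ℤ) : ∫ t : AddCircle (2 * π), (fourier m t).im = 0 := by
  have h := integral_im (𝕜 := ℂ)
    (integrable_of_continuous (f := fun t => fourier m t) (map_continuous _))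
  simp only [RCLike.im_to_complex] at h
  rw [h, integral_fourier]
  split_ifs <;> simp

theorem integrable_fourier_re (m : ℤ) :
    Integrable fun t : AddCircle (2 * π) => (fourier m t).re :=
  integrable_of_continuous (Complex.continuous_re.comp (map_continuous _))

theorem integrable_fourier_im (m : ℤ) :
    Integrable fun t : AddCircle (2 * π) => (fourier m t).im :=
  integrable_of_continuous (Complex.continuous_im.comp (map_continuous _))

theorem fourier_apply_sub_index (j k : ℤ) (t : AddCircle (2 * π)) :
    fourier (k - j) t = fourier k t * (starRingEnd ℂ) (fourier j t) := by
  rw [sub_eq_add_neg, fourier_add, fourier_neg]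

theorem coeffCLM_cosF_cosF (j k : ℕ) :
    coeffCLM (cosF j) (cosF k) = if j = k then (if k = 0 then 2 * π else π) else 0 := by
  have h (t : AddCircle (2 * π)) : cosF k t * cosF j t =
      ((fourier ((k : ℤ) + j) t).re + (fourier ((k : ℤ) - j) t).re) * (1 / 2) := by
    simp only [cosF_apply, fourier_add, fourier_apply_sub_index, Complex.mul_re, Complex.conj_re,
      Complex.conj_im]
    ring
  simp_rw [coeffCLM_apply, h]
  rw [integral_mul_const, integral_add (integrable_fourier_re _) (integrable_fourier_re _),
    integral_fourier_re, integral_fourier_re]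
  split_ifs <;> first | omega | ring

theorem coeffCLM_sinF_sinF (j k : ℕ) :
    coeffCLM (sinF j) (sinF k) = if j = k then (if k = 0 then 0 else π) else 0 := by
  have h (t : AddCircle (2 * π)) : sinF k t * sinF j t =
      ((fourier ((k : ℤ) - j) t).re - (fourier ((k : ℤ) + j) t).re) * (1 / 2) := by
    simp only [sinF_apply, fourier_add, fourier_apply_sub_index, Complex.mul_re, Complex.conj_re,
      Complex.conj_im]
    ring
  simp_rw [coeffCLM_apply, h]
  rw [integral_mul_const, integral_sub (integrable_fourier_re _) (integrable_fourier_re _),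
    integral_fourier_re, integral_fourier_re]
  split_ifs <;> first | omega | ring

theorem coeffCLM_cosF_sinF (j k : ℕ) : coeffCLM (cosF j) (sinF k) = 0 := by
  have h (t : AddCircle (2 * π)) : sinF k t * cosF j t =
      ((fourier ((k : ℤ) + j) t).im + (fourier ((k : ℤ) - j) t).im) * (1 / 2) := by
    simp only [cosF_apply, sinF_apply, fourier_add, fourier_apply_sub_index, Complex.mul_im,
      Complex.conj_re, Complex.conj_im]
    ring
  simp_rw [coeffCLM_apply, h]
  rw [integral_mul_const, integral_add (integrable_fourier_im _) (integrable_fourier_im _),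
    integral_fourier_im, integral_fourier_im]
  ring

theorem coeffCLM_comm (f g : C2pi) : coeffCLM f g = coeffCLM g f := by
  simp_rw [coeffCLM_apply, mul_comm]

theorem coeffCLM_sinF_cosF (j k : ℕ) : coeffCLM (sinF j) (cosF k) = 0 := by
  rw [coeffCLM_comm, coeffCLM_cosF_sinF]

theorem coeffCLM_cosF_eq_zero {n k : ℕ} (hk : n < k) {p : C2pi} (hp : p ∈ trigPoly n) :
    coeffCLM (cosF k) p = 0 := by
  have h : trigPoly n ≤ LinearMap.ker (coeffCLM (cosF k)).toLinearMap := by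
    refine Submodule.span_le.mpr ?_
    rintro _ ⟨j, hj, rfl | rfl⟩
    · simp [coeffCLM_cosF_cosF, show k ≠ j by omega]
    · simp [coeffCLM_cosF_sinF]
  exact h hp

theorem coeffCLM_sinF_eq_zero {n k : ℕ} (hk : n < k) {p : C2pi} (hp : p ∈ trigPoly n) :
    coeffCLM (sinF k) p = 0 := by
  have h : trigPoly n ≤ LinearMap.ker (coeffCLM (sinF k)).toLinearMap := by
    refine Submodule.span_le.mpr ?_
    rintro _ ⟨j, hj, rfl | rfl⟩
    · simp [coeffCLM_sinF_cosF]
    · simp [coeffCLM_sinF_sinF, show k ≠ j by omega]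
  exact h hp

theorem cosF_mem_trigPoly {n k : ℕ} (hk : k ≤ n) : cosF k ∈ trigPoly n :=
  Submodule.subset_span ⟨k, hk, Or.inl rfl⟩

theorem sinF_mem_trigPoly {n k : ℕ} (hk : k ≤ n) : sinF k ∈ trigPoly n :=
  Submodule.subset_span ⟨k, hk, Or.inr rfl⟩

theorem fourierProj_cosF (n k : ℕ) : fourierProj n (cosF k) = if k ≤ n then cosF k else 0 := by
  simp only [fourierProj, add_apply, smul_apply,
    ContinuousLinearMap.smulRight_apply, sum_apply, coeffCLM_cosF_cosF,
    coeffCLM_sinF_cosF, zero_smul, add_zero, ite_smul, smul_ite, smul_zero, Finset.sum_ite_eq',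
    Finset.mem_Icc]
  have hπ := Real.pi_ne_zero
  rcases Nat.eq_zero_or_pos k with rfl | hk
  · simp [smul_smul]
    field_simp
    simp
  · simp [smul_smul, hπ, hk.ne, hk.ne', Nat.one_le_iff_ne_zero]

theorem fourierProj_sinF (n k : ℕ) : fourierProj n (sinF k) = if k ≤ n then sinF k else 0 := by
  simp only [fourierProj, add_apply, smul_apply,
    ContinuousLinearMap.smulRight_apply, sum_apply, coeffCLM_cosF_sinF,
    coeffCLM_sinF_sinF, zero_smul, zero_add, ite_smul, smul_ite, smul_zero, Finset.sum_ite_eq',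
    Finset.mem_Icc]
  have hπ := Real.pi_ne_zero
  rcases Nat.eq_zero_or_pos k with rfl | hk
  · simp [sinF_zero]
  · simp [smul_smul, hπ, hk.ne', Nat.one_le_iff_ne_zero]

/-- Translation `f ↦ f(· + s)` by an element of the circle. -/
noncomputable def circleShift (s : AddCircle (2 * π)) (f : C2pi) : C2pi :=
  f.comp ⟨fun t => t + s, by fun_prop⟩

theorem circleShift_apply (s t : AddCircle (2 * π)) (f : C2pi) :
    circleShift s f t = f (t + s) := rfl

theorem norm_circleShift_le (s : AddCircle (2 * π)) (f : C2pi) : ‖circleShift s f‖ ≤ ‖f‖ :=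
  (ContinuousMap.norm_le _ (norm_nonneg _)).mpr fun _ => f.norm_coe_le_norm _

theorem continuous_circleShift (f : C2pi) : Continuous fun s => circleShift s f := by
  refine ContinuousMap.continuous_of_continuous_uncurry _ ?_
  exact f.continuous.comp (continuous_snd.add continuous_fst)

theorem circleShift_cosF (s : AddCircle (2 * π)) (k : ℕ) :
    circleShift s (cosF k) = cosF k s • cosF k - sinF k s • sinF k := by
  ext t
  simp [circleShift_apply, cosF_add, mul_comm]

theorem circleShift_sinF (s : AddCircle (2 * π)) (k : ℕ) :
    circleShift s (sinF k) = sinF k s • cosF k + cosF k s • sinF k := by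
  ext t
  simp [circleShift_apply, sinF_add, mul_comm]

/-- The function `t ↦ (P (T_{x - t} f))(t)`, whose mean is the value at `x` of the average of the
translates of `P`. -/
noncomputable def conjugates (P : C2pi →L[ℝ] C2pi) (x : AddCircle (2 * π)) : C2pi →ₗ[ℝ] C2pi where
  toFun f := ⟨fun t => P (circleShift (x - t) f) t, by
    have h : Continuous fun t => P (circleShift (x - t) f) :=
      P.continuous.comp ((continuous_circleShift f).comp (continuous_const.sub continuous_id))
    exact continuous_eval.comp (h.prodMk continuous_id)⟩
  map_add' f g := by
    ext t
    have h : circleShift (x - t) (f + g) = circleShift (x - t) f + circleShift (x - t) g := rfl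
    simp [h]
  map_smul' c f := by
    ext t
    have h : circleShift (x - t) (c • f) = c • circleShift (x - t) f := rfl
    simp [h]

theorem norm_conjugates_le (P : C2pi →L[ℝ] C2pi) (x : AddCircle (2 * π)) (f : C2pi) :
    ‖conjugates P x f‖ ≤ ‖P‖ * ‖f‖ := by
  refine (ContinuousMap.norm_le _ (by positivity)).mpr fun t => ?_
  calc ‖P (circleShift (x - t) f) t‖ ≤ ‖P (circleShift (x - t) f)‖ :=
        ContinuousMap.norm_coe_le_norm _ _
    _ ≤ ‖P‖ * ‖circleShift (x - t) f‖ := P.le_opNorm _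
    _ ≤ ‖P‖ * ‖f‖ := by gcongr; exact norm_circleShift_le _ _

/-- The bounded operator underlying `conjugates`. -/
noncomputable def conjugatesCLM (P : C2pi →L[ℝ] C2pi) (x : AddCircle (2 * π)) : C2pi →L[ℝ] C2pi :=
  (conjugates P x).mkContinuous ‖P‖ (norm_conjugates_le P x)

theorem conjugatesCLM_apply (P : C2pi →L[ℝ] C2pi) (x t : AddCircle (2 * π)) (f : C2pi) :
    conjugatesCLM P x f t = P (circleShift (x - t) f) t := rfl

theorem abs_coeffCLM_one_le (f : C2pi) : |coeffCLM 1 f| ≤ 2 * π * ‖f‖ := by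
  have h := norm_integral_le_of_norm_le_const (μ := (volume : Measure (AddCircle (2 * π))))
    (Filter.Eventually.of_forall f.norm_coe_le_norm)
  rw [Measure.real, AddCircle.measure_univ, ENNReal.toReal_ofReal (by positivity)] at h
  simpa [coeffCLM_apply, mul_comm] using h

theorem coeffCLM_one_mul (f g : C2pi) : coeffCLM 1 (g * f) = coeffCLM g f := by
  simp [coeffCLM_apply, mul_comm]

theorem coeffCLM_one_const (c : ℝ) : coeffCLM 1 (ContinuousMap.const _ c) = 2 * π * c := by
  simp [coeffCLM_apply, Measure.real, AddCircle.measure_univ, Real.pi_pos.le]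

/-- The span of all `cos (k t)` and `sin (k t)` is dense in `C(2π)`. -/
theorem dense_span_cosF_sinF :
    Dense (Submodule.span ℝ {f : C2pi | ∃ k : ℕ, f = cosF k ∨ f = sinF k} : Set C2pi) := by
  set S := Submodule.span ℝ {f : C2pi | ∃ k : ℕ, f = cosF k ∨ f = sinF k}
  let re : C(AddCircle (2 * π), ℂ) →L[ℝ] C2pi :=
    Complex.reCLM.compLeftContinuous ℝ (AddCircle (2 * π))
  have hfourier (m : ℤ) (c : ℂ) : re (c • fourier m) ∈ S := by
    have hc (k : ℕ) : cosF k ∈ S := Submodule.subset_span ⟨k, Or.inl rfl⟩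
    have hs (k : ℕ) : sinF k ∈ S := Submodule.subset_span ⟨k, Or.inr rfl⟩
    obtain ⟨k, rfl | rfl⟩ := m.eq_nat_or_neg
    · convert S.sub_mem (S.smul_mem c.re (hc k)) (S.smul_mem c.im (hs k)) using 1
      ext t
      simp [re, cosF_apply, sinF_apply]
    · convert S.add_mem (S.smul_mem c.re (hc k)) (S.smul_mem c.im (hs k)) using 1
      ext t
      simp [re, cosF_apply, sinF_apply, fourier_neg, -fourier_apply]
  have hspan (g : C(AddCircle (2 * π), ℂ)) (hg : g ∈ Submodule.span ℂ (Set.range fourier)) :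
      re g ∈ S := by
    obtain ⟨c, rfl⟩ := (Finsupp.mem_span_range_iff_exists_finsupp).mp hg
    rw [Finsupp.sum, map_sum]
    exact S.sum_mem fun m _ => hfourier m _
  have hdense : Dense (Submodule.span ℂ (Set.range (fourier (T := 2 * π))) :
      Set C(AddCircle (2 * π), ℂ)) :=
    Submodule.dense_iff_topologicalClosure_eq_top.mpr span_fourier_closure_eq_top
  have hsurj : Function.Surjective re := fun f =>
    ⟨⟨fun t => (f t : ℂ), by fun_prop⟩, by ext t; simp [re]⟩
  refine (hsurj.denseRange.dense_image re.continuous hdense).mono ?_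
  rintro _ ⟨g, hg, rfl⟩
  exact hspan g hg

/-- Averaging the translates of a projection onto `Π_n` gives the Fourier projection. -/
theorem coeffCLM_conjugates_eq_fourierProj {n : ℕ} {P : C2pi →L[ℝ] C2pi}
    (hPrange : ∀ f : C2pi, P f ∈ trigPoly n) (hPproj : ∀ f ∈ trigPoly n, P f = f)
    (x : AddCircle (2 * π)) (f : C2pi) :
    coeffCLM 1 (conjugatesCLM P x f) = 2 * π * fourierProj n f x := by
  have hsmall {g : C2pi} (hg : ∀ s, circleShift s g ∈ trigPoly n) :
      coeffCLM 1 (conjugatesCLM P x g) = 2 * π * g x := by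
    rw [← coeffCLM_one_const]
    congr 1
    ext t
    simp [conjugatesCLM_apply, hPproj _ (hg _), circleShift_apply]
  have hlarge {k : ℕ} (hk : n < k) (a b c d : ℝ) (p q : C2pi) :
      coeffCLM 1 (a • (cosF k * P p) + b • (sinF k * P p) + c • (cosF k * P q) +
        d • (sinF k * P q)) = 0 := by
    simp [coeffCLM_one_mul, coeffCLM_cosF_eq_zero hk (hPrange _),
      coeffCLM_sinF_eq_zero hk (hPrange _)]
  let A : C2pi →L[ℝ] ℝ := (coeffCLM 1).comp (conjugatesCLM P x)
  let B : C2pi →L[ℝ] ℝ := (2 * π) • (ContinuousMap.evalCLM ℝ x).comp (fourierProj n)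
  suffices h : A = B from congrArg (fun L : C2pi →L[ℝ] ℝ => L f) h
  refine ContinuousLinearMap.ext_on dense_span_cosF_sinF ?_
  rintro _ ⟨k, rfl | rfl⟩
  · change coeffCLM 1 (conjugatesCLM P x (cosF k)) = 2 * π * fourierProj n (cosF k) x
    rw [fourierProj_cosF]
    split_ifs with hk
    · refine hsmall fun s => ?_
      rw [circleShift_cosF]
      exact Submodule.sub_mem _ (Submodule.smul_mem _ _ (cosF_mem_trigPoly hk))
        (Submodule.smul_mem _ _ (sinF_mem_trigPoly hk))
    · rw [ContinuousMap.zero_apply, mul_zero, ← hlarge (not_le.mp hk) (cosF k x) (sinF k x)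
        (-sinF k x) (cosF k x) (cosF k) (sinF k)]
      congr 1
      ext t
      simp [conjugatesCLM_apply, circleShift_cosF, cosF_sub, sinF_sub]
      ring
  · change coeffCLM 1 (conjugatesCLM P x (sinF k)) = 2 * π * fourierProj n (sinF k) x
    rw [fourierProj_sinF]
    split_ifs with hk
    · refine hsmall fun s => ?_
      rw [circleShift_sinF]
      exact Submodule.add_mem _ (Submodule.smul_mem _ _ (cosF_mem_trigPoly hk))
        (Submodule.smul_mem _ _ (sinF_mem_trigPoly hk))
    · rw [ContinuousMap.zero_apply, mul_zero, ← hlarge (not_le.mp hk) (sinF k x) (-cosF k x)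
        (cosF k x) (sinF k x) (cosF k) (sinF k)]
      congr 1
      ext t
      simp [conjugatesCLM_apply, circleShift_sinF, cosF_sub, sinF_sub]
      ring

/-- Lozinskii's theorem: the Fourier projection `F_n` is a minimal projection of
`C(2π)` onto `Π_n` with respect to the operator norm. -/
theorem lozinskii_fourierProj_minimal (n : ℕ) (P : C2pi →L[ℝ] C2pi)
    (hPrange : ∀ f : C2pi, P f ∈ trigPoly n)
    (hPproj : ∀ f ∈ trigPoly n, P f = f) :
    ‖fourierProj n‖ ≤ ‖P‖ := by
  refine (fourierProj n).opNorm_le_bound (norm_nonneg P) fun f => ?_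
  refine (ContinuousMap.norm_le _ (by positivity)).mpr fun x => ?_
  have h := (abs_coeffCLM_one_le (conjugatesCLM P x f)).trans
    (mul_le_mul_of_nonneg_left (norm_conjugates_le P x f) Real.two_pi_pos.le)
  rw [coeffCLM_conjugates_eq_fourierProj hPrange hPproj, abs_mul,
    abs_of_pos Real.two_pi_pos] at h
  exact le_of_mul_le_mul_left h Real.two_pi_pos
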